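/- arXiv:1408.3427 — 6 statements merged into one kernel-verified Lean document; each statement's English description precedes it below -/
import Mathlib

section
/- Uniform Inverse Function Theorem: Let U and V be open subsets of ℝ^d and let F: U → V be differentiable with invertible derivative dF_x at every x ∈ U. Suppose there are constants K > 0, H > 0 and β ∈ (0,1] such that ‖dF_x‖ ≤ K and ‖(dF_x)^{-1}‖ ≤ K for all x ∈ U, and ‖dF_{x₁} − dF_{x₂}‖ ≤ H‖x₁ − x₂‖^β for all x₁, x₂ ∈ U. Let x ∈ U and ε > 0 satisfy B_ε(x) ⊆ U and 0 < ε < 2^{−(β+1)/β}(KH)^{−1/β}. Then, with δ := ε/(2K) and W := B_δ(F(x)): (1) there is a differentiable map G: W → U with G(F(x)) = x and F(G(y)) = y for all y ∈ W, and G is an open map; (2) ‖dG_{y₁} − dG_{y₂}‖ ≤ K³H‖y₁ − y₂‖^β for all y₁, y₂ ∈ W. -/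
open Metric Set in
/-- A map whose derivative stays close to an invertible `A` on a ball, relative to a bound `K` for
`‖A⁻¹‖`, has a local inverse on a ball of explicit radius. -/
theorem exists_openPartialHomeomorph_of_norm_fderiv_sub_le {E : Type*} [NormedAddCommGroup E]
    [NormedSpace ℝ E] [CompleteSpace E] [Nontrivial E] {F : E → E} {F' : E → E ≃L[ℝ] E} {x : E}
    {ε K c : ℝ} (hc : 0 ≤ c) (hKc : K * c < 1 / 2)
    (hderiv : ∀ z ∈ ball x ε, HasFDerivAt F (F' z : E →L[ℝ] E) z)
    (hinv : ‖((F' x).symm : E →L[ℝ] E)‖ ≤ K)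
    (hsub : ∀ z ∈ ball x ε, ‖(F' z : E →L[ℝ] E) - (F' x : E →L[ℝ] E)‖ ≤ c) :
    ∃ e : OpenPartialHomeomorph E E, ⇑e = F ∧ e.source = ball x ε ∧
      ball (F x) (ε / (2 * K)) ⊆ e.target := by
  have hN : 0 < ‖((F' x).symm : E →L[ℝ] E)‖ := (F' x).norm_symm_pos
  have hK : 0 < K := hN.trans_le hinv
  have hKN : K⁻¹ ≤ ‖((F' x).symm : E →L[ℝ] E)‖⁻¹ := inv_anti₀ hN hinv
  have hc2 : c < K⁻¹ / 2 := by
    rw [inv_eq_one_div, div_div, lt_div_iff₀ (by positivity)]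
    linarith
  have hKpos : 0 < K⁻¹ := inv_pos.2 hK
  lift c to NNReal using hc
  have happ : ApproximatesLinearOn F (F' x : E →L[ℝ] E) (ball x ε) c := fun y hy z hz =>
    (convex_ball x ε).norm_image_sub_le_of_norm_hasFDerivWithin_le'
      (fun w hw => (hderiv w hw).hasFDerivWithinAt) hsub hz hy
  have hcN : Subsingleton E ∨ c < ‖((F' x).symm : E →L[ℝ] E)‖₊⁻¹ := by
    refine Or.inr ?_
    rw [← NNReal.coe_lt_coe, NNReal.coe_inv, coe_nnnorm]
    linarith
  refine ⟨happ.toOpenPartialHomeomorph F (ball x ε) hcN isOpen_ball, rfl, rfl, fun y hy => ?_⟩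
  rw [mem_ball, lt_div_iff₀ (by positivity)] at hy
  refine happ.closedBall_subset_target hcN isOpen_ball (ε := 2 * K * dist y (F x)) (by positivity)
    (closedBall_subset_ball (by linarith)) ?_
  rw [mem_closedBall, NNReal.coe_inv, coe_nnnorm]
  calc dist y (F x) = K⁻¹ / 2 * (2 * K * dist y (F x)) := by field_simp
    _ ≤ _ := by
      gcongr
      linarith

/-- The resolvent-type estimate for the difference of two inverses. -/
theorem ContinuousLinearEquiv.norm_symm_sub_symm_le {E F : Type*} [NormedAddCommGroup E]
    [NormedSpace ℝ E] [NormedAddCommGroup F] [NormedSpace ℝ F] (A B : E ≃L[ℝ] F) :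
    ‖(A.symm : F →L[ℝ] E) - (B.symm : F →L[ℝ] E)‖ ≤
      ‖(A.symm : F →L[ℝ] E)‖ * (‖(A : E →L[ℝ] F) - (B : E →L[ℝ] F)‖ *
        ‖(B.symm : F →L[ℝ] E)‖) := by
  have h : (A.symm : F →L[ℝ] E) - (B.symm : F →L[ℝ] E) =
      -((A.symm : F →L[ℝ] E).comp
        (((A : E →L[ℝ] F) - (B : E →L[ℝ] F)).comp (B.symm : F →L[ℝ] E))) := by
    ext y
    simp
  rw [h, norm_neg]
  refine (ContinuousLinearMap.opNorm_comp_le _ _).trans ?_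
  gcongr
  exact ContinuousLinearMap.opNorm_comp_le _ _

theorem mul_rpow_lt_half_of_lt_rpow {a β ε : ℝ} (ha : 0 < a) (hβ : 0 < β) (hε : 0 ≤ ε)
    (h : ε < (2 : ℝ) ^ (-(β + 1) / β) * a ^ (-1 / β)) : a * ε ^ β < 1 / 2 := by
  have h1 := Real.rpow_lt_rpow hε h hβ
  rw [Real.mul_rpow (by positivity) (by positivity), ← Real.rpow_mul (by norm_num),
    ← Real.rpow_mul ha.le, div_mul_cancel₀ _ hβ.ne', div_mul_cancel₀ _ hβ.ne',
    Real.rpow_neg_one, ← div_eq_mul_inv, lt_div_iff₀ ha] at h1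
  have h2 : (2 : ℝ) ^ (-(β + 1)) ≤ 2 ^ (-1 : ℝ) :=
    Real.rpow_le_rpow_of_exponent_le (by norm_num) (by linarith)
  rw [Real.rpow_neg_one] at h2
  linarith


/-- Uniform Inverse Function Theorem. -/
theorem stmt0 (d : ℕ) (U V : Set (EuclideanSpace ℝ (Fin d)))
    (hU : IsOpen U) (hV : IsOpen V)
    (F : EuclideanSpace ℝ (Fin d) → EuclideanSpace ℝ (Fin d))
    (hFUV : Set.MapsTo F U V)
    (F' : EuclideanSpace ℝ (Fin d) → (EuclideanSpace ℝ (Fin d) ≃L[ℝ] EuclideanSpace ℝ (Fin d)))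
    (hderiv : ∀ x ∈ U,
      HasFDerivAt F (F' x : EuclideanSpace ℝ (Fin d) →L[ℝ] EuclideanSpace ℝ (Fin d)) x)
    (K H β : ℝ) (hK : 0 < K) (hH : 0 < H) (hβ : 0 < β) (hβ1 : β ≤ 1)
    (hboundF : ∀ x ∈ U,
      ‖(F' x : EuclideanSpace ℝ (Fin d) →L[ℝ] EuclideanSpace ℝ (Fin d))‖ ≤ K)
    (hboundFinv : ∀ x ∈ U,
      ‖((F' x).symm : EuclideanSpace ℝ (Fin d) →L[ℝ] EuclideanSpace ℝ (Fin d))‖ ≤ K)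
    (hHolder : ∀ x₁ ∈ U, ∀ x₂ ∈ U,
      ‖(F' x₁ : EuclideanSpace ℝ (Fin d) →L[ℝ] EuclideanSpace ℝ (Fin d)) -
        (F' x₂ : EuclideanSpace ℝ (Fin d) →L[ℝ] EuclideanSpace ℝ (Fin d))‖ ≤
          H * ‖x₁ - x₂‖ ^ β)
    (x : EuclideanSpace ℝ (Fin d)) (hx : x ∈ U)
    (ε : ℝ) (hε : 0 < ε) (hball : Metric.ball x ε ⊆ U)
    (hεsmall : ε < (2 : ℝ) ^ (-(β + 1) / β) * (K * H) ^ (-1 / β)) :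
    ∃ (G : EuclideanSpace ℝ (Fin d) → EuclideanSpace ℝ (Fin d))
      (G' : EuclideanSpace ℝ (Fin d) → (EuclideanSpace ℝ (Fin d) →L[ℝ] EuclideanSpace ℝ (Fin d))),
      G (F x) = x ∧
      (∀ y ∈ Metric.ball (F x) (ε / (2 * K)),
        F (G y) = y ∧ G y ∈ U ∧ HasFDerivAt G (G' y) y) ∧
      (∀ s : Set (EuclideanSpace ℝ (Fin d)),
        s ⊆ Metric.ball (F x) (ε / (2 * K)) → IsOpen s → IsOpen (G '' s)) ∧
      (∀ y₁ ∈ Metric.ball (F x) (ε / (2 * K)), ∀ y₂ ∈ Metric.ball (F x) (ε / (2 * K)),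
        ‖G' y₁ - G' y₂‖ ≤ K ^ 3 * H * ‖y₁ - y₂‖ ^ β) := by
  rcases subsingleton_or_nontrivial (EuclideanSpace ℝ (Fin d)) with hE | hE
  · refine ⟨id, fun _ => 0, Subsingleton.elim _ _, fun y _ => ⟨Subsingleton.elim _ _, ?_,
      hasFDerivAt_of_subsingleton _ _⟩, fun s _ hs => by simp, fun y₁ _ y₂ _ => ?_⟩
    · rwa [Subsingleton.elim (id y) x]
    · rw [sub_self, norm_zero]
      positivity
  have hsmall : K * (H * ε ^ β) < 1 / 2 := by
    rw [← mul_assoc]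
    exact mul_rpow_lt_half_of_lt_rpow (by positivity) hβ hε.le hεsmall
  obtain ⟨e, he, hsource, htarget⟩ := exists_openPartialHomeomorph_of_norm_fderiv_sub_le
    (by positivity) hsmall (fun z hz => hderiv z (hball hz)) (hboundFinv x hx) fun z hz =>
      (hHolder z (hball hz) x hx).trans (by
        have := mem_ball_iff_norm.1 hz
        gcongr)
  have hGU : ∀ y ∈ Metric.ball (F x) (ε / (2 * K)), e.symm y ∈ U := fun y hy =>
    hball (hsource ▸ e.map_target (htarget hy))
  have hG : ∀ y ∈ Metric.ball (F x) (ε / (2 * K)), HasFDerivAt e.symm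
      ((F' (e.symm y)).symm : EuclideanSpace ℝ (Fin d) →L[ℝ] EuclideanSpace ℝ (Fin d)) y :=
    fun y hy => e.hasFDerivAt_symm (htarget hy) (he ▸ hderiv _ (hGU y hy))
  refine ⟨e.symm, fun y => (F' (e.symm y)).symm, ?_, fun y hy => ⟨?_, hGU y hy, hG y hy⟩,
    fun s hs hso => e.isOpen_image_symm_of_subset_target hso (hs.trans htarget),
    fun y₁ h₁ y₂ h₂ => ?_⟩
  · rw [← he]
    exact e.left_inv (hsource ▸ Metric.mem_ball_self hε)
  · rw [← he]
    exact e.right_inv (htarget hy)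
  have hK1 : 1 ≤ K := by
    have hKK : 1 ≤ K * K := (F' x).one_le_norm_mul_norm_symm.trans
      (mul_le_mul (hboundF x hx) (hboundFinv x hx) (norm_nonneg _) hK.le)
    nlinarith
  have hlip : ‖e.symm y₁ - e.symm y₂‖ ≤ K * ‖y₁ - y₂‖ :=
    (convex_ball _ _).norm_image_sub_le_of_norm_hasFDerivWithin_le
      (fun y hy => (hG y hy).hasFDerivWithinAt) (fun y hy => hboundFinv _ (hGU y hy)) h₂ h₁
  have hpow : ‖e.symm y₁ - e.symm y₂‖ ^ β ≤ K * ‖y₁ - y₂‖ ^ β :=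
    calc ‖e.symm y₁ - e.symm y₂‖ ^ β ≤ (K * ‖y₁ - y₂‖) ^ β := by gcongr
      _ = K ^ β * ‖y₁ - y₂‖ ^ β := Real.mul_rpow hK.le (norm_nonneg _)
      _ ≤ K * ‖y₁ - y₂‖ ^ β := by
        gcongr
        exact Real.rpow_le_self_of_one_le hK1 hβ1
  calc _ ≤ _ := ContinuousLinearEquiv.norm_symm_sub_symm_le _ _
    _ ≤ K * (H * (K * ‖y₁ - y₂‖ ^ β) * K) := by
      gcongr
      · exact hboundFinv _ (hGU y₁ h₁)
      · refine (hHolder _ (hGU y₁ h₁) _ (hGU y₂ h₂)).trans ?_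
        gcongr
      · exact hboundFinv _ (hGU y₂ h₂)
    _ = K ^ 3 * H * ‖y₁ - y₂‖ ^ β := by ring
end

section
/- Fix ε > 0. Suppose Q_0, Q_1, Q_2 > 0 and 0 < p^u_i, p^s_i ≤ Q_i for i = 0,1,2 satisfy p^u_{i+1} = min{e^ε p^u_i, Q_{i+1}} and p^s_i = min{e^ε p^s_{i+1}, Q_i} for i = 0,1. Then, setting η_i := min{p^u_i, p^s_i}, one has e^{−ε} ≤ η_{i+1}/η_i ≤ e^{ε} for i = 0,1. -/
/-- If `0 < pᵘᵢ, pˢᵢ ≤ Qᵢ` for `i = 0,1,2` satisfy the recurrences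
`pᵘ_{i+1} = min (e^ε pᵘᵢ) Q_{i+1}` and `pˢᵢ = min (e^ε pˢ_{i+1}) Qᵢ` for `i = 0,1`,
then `η_{i+1}/ηᵢ ∈ [e^{-ε}, e^ε]` for `i = 0,1`, where `ηᵢ := min pᵘᵢ pˢᵢ`. -/
theorem stmt1 (ε : ℝ) (hε : 0 < ε) (pu ps Q : ℕ → ℝ)
    (hQpos : ∀ i ≤ 2, 0 < Q i)
    (hpos : ∀ i ≤ 2, 0 < pu i ∧ 0 < ps i)
    (hle : ∀ i ≤ 2, pu i ≤ Q i ∧ ps i ≤ Q i)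
    (hu : ∀ i ≤ 1, pu (i + 1) = min (Real.exp ε * pu i) (Q (i + 1)))
    (hs : ∀ i ≤ 1, ps i = min (Real.exp ε * ps (i + 1)) (Q i)) :
    ∀ i ≤ 1, Real.exp (-ε) ≤ min (pu (i + 1)) (ps (i + 1)) / min (pu i) (ps i) ∧
      min (pu (i + 1)) (ps (i + 1)) / min (pu i) (ps i) ≤ Real.exp ε := by
  intro i hi
  obtain ⟨ha, hb⟩ := hpos i (by omega)
  obtain ⟨ha', hb'⟩ := hpos (i + 1) (by omega)
  obtain ⟨haQ, -⟩ := hle i (by omega)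
  obtain ⟨-, hbQ'⟩ := hle (i + 1) (by omega)
  have hE : 1 < Real.exp ε := Real.one_lt_exp_iff.mpr hε
  have hE0 : 0 < Real.exp ε := Real.exp_pos ε
  have hua : pu (i + 1) ≤ Real.exp ε * pu i := (hu i hi).trans_le (min_le_left _ _)
  have hsb : ps i ≤ Real.exp ε * ps (i + 1) := (hs i hi).trans_le (min_le_left _ _)
  have hη : 0 < min (pu i) (ps i) := lt_min ha hb
  constructor
  · rw [le_div_iff₀ hη, Real.exp_neg, inv_mul_le_iff₀ hE0, mul_min_of_nonneg _ _ hE0.le]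
    refine le_min ?_ ((min_le_right _ _).trans hsb)
    rcases min_choice (Real.exp ε * pu i) (Q (i + 1)) with h | h
    · rw [hu i hi, h]
      refine (min_le_left _ _).trans ?_
      nlinarith [mul_pos hE0 ha]
    · rw [hu i hi, h]
      exact (min_le_right _ _).trans (hsb.trans (by gcongr))
  · rw [div_le_iff₀ hη, mul_min_of_nonneg _ _ hE0.le]
    refine le_min ((min_le_left _ _).trans hua) ?_
    rcases min_choice (Real.exp ε * ps (i + 1)) (Q i) with h | h
    · rw [hs i hi, h]
      refine (min_le_right _ _).trans ?_
      nlinarith [mul_pos hE0 hb']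
    · rw [hs i hi, h]
      exact (min_le_left _ _).trans (hua.trans (by gcongr))
end

section
/- First Subordination Lemma: Let ε > 0 and let {q_n}_{n∈ℤ} and {Q_n}_{n∈ℤ} be sequences with values in I_ε. If 0 < q_n ≤ Q_n and e^{−ε} ≤ q_n/q_{n+1} ≤ e^{ε} for every n ∈ ℤ, then there exists a sequence {(p^u_n, p^s_n)}_{n∈ℤ} which is ε-subordinated to {Q_n}_{n∈ℤ} and satisfies min{p^u_n, p^s_n} ≥ q_n for all n ∈ ℤ. -/
/-- `I_ε := {e^{-ℓε/3} : ℓ ∈ ℕ}`. -/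
def Ieps (ε : ℝ) : Set ℝ := {x | ∃ ℓ : ℕ, x = Real.exp (-((ℓ : ℝ) * ε) / 3)}

/-- `{(pᵘₙ, pˢₙ)}_{n ∈ ℤ}` is `ε`-subordinated to `{Qₙ}_{n ∈ ℤ}`. -/
def Subordinated (ε : ℝ) (Q pu ps : ℤ → ℝ) : Prop :=
  ∀ n : ℤ, (0 < pu n ∧ 0 < ps n) ∧ (pu n ≤ Q n ∧ ps n ≤ Q n) ∧
    (pu n ∈ Ieps ε ∧ ps n ∈ Ieps ε) ∧
    pu (n + 1) = min (Real.exp ε * pu n) (Q (n + 1)) ∧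
    ps (n - 1) = min (Real.exp ε * ps n) (Q (n - 1))

/-- If `L ≤ l` and `l` decreases by at most `c` at each step, the recursion
`a (n + 1) = max (a n - c) (L (n + 1))` has a solution on `ℤ` lying between `L` and `l`. -/
theorem exists_max_sub_recursion (c : ℕ) (L l : ℤ → ℕ) (hL : ∀ n, L n ≤ l n)
    (hl : ∀ n, l n ≤ l (n + 1) + c) :
    ∃ a : ℤ → ℕ, ∀ n, L n ≤ a n ∧ a n ≤ l n ∧ a (n + 1) = max (a n - c) (L (n + 1)) := by
  have hback (n : ℤ) (k : ℕ) : l (n - k) ≤ l n + c * k := by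
    induction k with
    | zero => simp
    | succ k ih =>
      have h := hl (n - (k + 1 : ℕ))
      rw [show n - ((k + 1 : ℕ) : ℤ) + 1 = n - k by push_cast; ring] at h
      rw [Nat.mul_succ]
      lia
  have hle (n : ℤ) (k : ℕ) : L (n - k) - c * k ≤ l n := by
    have h₁ := hback n k
    have h₂ := hL (n - k)
    lia
  have hbdd (n : ℤ) : BddAbove (Set.range fun k : ℕ => L (n - k) - c * k) :=
    ⟨l n, by rintro _ ⟨k, rfl⟩; exact hle n k⟩
  have hmem (n : ℤ) (k : ℕ) : L (n - k) - c * k ≤ ⨆ k : ℕ, (L (n - k) - c * k) :=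
    le_ciSup (hbdd n) k
  refine ⟨fun n => ⨆ k : ℕ, (L (n - k) - c * k), fun n => ⟨?_, ciSup_le (hle n), ?_⟩⟩
  · simpa using hmem n 0
  · apply le_antisymm
    · refine ciSup_le fun k => ?_
      cases k with
      | zero => simp
      | succ k =>
        have h := hmem n k
        rw [show n + 1 - ((k + 1 : ℕ) : ℤ) = n - k by push_cast; ring, Nat.mul_succ]
        apply le_max_of_le_left
        lia
    · apply max_le
      · rw [Nat.sub_le_iff_le_add]
        refine ciSup_le fun k => ?_
        have h := hmem (n + 1) (k + 1)
        rw [show n + 1 - ((k + 1 : ℕ) : ℤ) = n - k by push_cast; ring, Nat.mul_succ] at h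
        lia
      · simpa using hmem (n + 1) 0

/-- The one-sided version of the subordination lemma. -/
theorem exists_forward_subordinated (ε : ℝ) (hε : 0 < ε) (q Q : ℤ → ℝ)
    (hqI : ∀ n, q n ∈ Ieps ε) (hQI : ∀ n, Q n ∈ Ieps ε) (hqQ : ∀ n, q n ≤ Q n)
    (hrat : ∀ n, q (n + 1) ≤ Real.exp ε * q n) :
    ∃ p : ℤ → ℝ, ∀ n, q n ≤ p n ∧ p n ≤ Q n ∧ p n ∈ Ieps ε ∧
      p (n + 1) = min (Real.exp ε * p n) (Q (n + 1)) := by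
  choose l hl using hqI
  choose L hL using hQI
  have exp_le_iff (i j : ℕ) :
      Real.exp (-((i : ℝ) * ε) / 3) ≤ Real.exp (-((j : ℝ) * ε) / 3) ↔ j ≤ i := by
    rw [Real.exp_le_exp, div_le_div_iff_of_pos_right (by norm_num), neg_le_neg_iff,
      mul_le_mul_iff_of_pos_right hε, Nat.cast_le]
  have exp_le_mul_iff (i j : ℕ) :
      Real.exp (-((i : ℝ) * ε) / 3) ≤ Real.exp ε * Real.exp (-((j : ℝ) * ε) / 3) ↔
        j ≤ i + 3 := by
    have h : Real.exp (-((i : ℝ) * ε) / 3) =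
        Real.exp ε * Real.exp (-(((i + 3 : ℕ) : ℝ) * ε) / 3) := by
      rw [← Real.exp_add]
      congr 1
      push_cast
      ring
    rw [h, mul_le_mul_iff_of_pos_left (Real.exp_pos ε), exp_le_iff]
  obtain ⟨a, ha⟩ := exists_max_sub_recursion 3 L l
    (fun n => by have h := hqQ n; rwa [hl, hL, exp_le_iff] at h)
    (fun n => by have h := hrat n; rwa [hl, hl n, exp_le_mul_iff] at h)
  refine ⟨fun n => Real.exp (-((a n : ℝ) * ε) / 3), fun n => ?_⟩
  obtain ⟨h₁, h₂, h₃⟩ := ha n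
  refine ⟨by rwa [hl, exp_le_iff], by rwa [hL, exp_le_iff], ⟨a n, rfl⟩, ?_⟩
  beta_reduce
  apply le_antisymm
  · apply le_min
    · rw [exp_le_mul_iff]
      lia
    · rw [hL, exp_le_iff]
      lia
  · rcases le_total (a n - 3) (L (n + 1)) with h | h
    · rw [h₃, max_eq_right h, ← hL]
      exact min_le_right _ _
    · by_cases h3 : 3 ≤ a n
      · apply min_le_of_left_le
        apply le_of_eq
        rw [h₃, max_eq_left h, Nat.cast_sub h3, ← Real.exp_add]
        congr 1
        push_cast
        ring
      · apply min_le_of_right_le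
        rw [hL, exp_le_iff]
        lia

/-- First Subordination Lemma. -/
theorem stmt2 (ε : ℝ) (hε : 0 < ε) (q Q : ℤ → ℝ)
    (hqI : ∀ n, q n ∈ Ieps ε) (hQI : ∀ n, Q n ∈ Ieps ε)
    (hq : ∀ n, 0 < q n ∧ q n ≤ Q n)
    (hrat : ∀ n, Real.exp (-ε) ≤ q n / q (n + 1) ∧ q n / q (n + 1) ≤ Real.exp ε) :
    ∃ pu ps : ℤ → ℝ, Subordinated ε Q pu ps ∧ ∀ n, q n ≤ min (pu n) (ps n) := by
  obtain ⟨pu, hu⟩ := exists_forward_subordinated ε hε q Q hqI hQI (fun n => (hq n).2) fun n => by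
    have h := (hrat n).1
    rwa [le_div_iff₀ (hq _).1, Real.exp_neg, inv_mul_le_iff₀ (Real.exp_pos ε)] at h
  obtain ⟨ps, hs⟩ := exists_forward_subordinated ε hε (fun n => q (-n)) (fun n => Q (-n))
    (fun n => hqI _) (fun n => hQI _) (fun n => (hq _).2) fun n => by
      have h := (hrat (-(n + 1))).2
      rwa [div_le_iff₀ (hq _).1, show -(n + 1) + 1 = -n by ring] at h
  refine ⟨pu, fun n => ps (-n), fun n => ?_, fun n => le_min (hu n).1 ?_⟩
  · obtain ⟨u₁, u₂, u₃, u₄⟩ := hu n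
    obtain ⟨s₁, s₂, s₃, s₄⟩ := hs (-n)
    simp only [neg_neg] at s₁ s₂
    rw [show -(-n + 1) = n - 1 by ring, show -n + 1 = -(n - 1) by ring] at s₄
    exact ⟨⟨(hq n).1.trans_le u₁, (hq n).1.trans_le s₁⟩, ⟨u₂, s₂⟩, ⟨u₃, s₃⟩, u₄, s₄⟩
  · simpa using (hs (-n)).1
end

section
/- Second Subordination Lemma: Let ε > 0 and suppose {(p^u_n, p^s_n)}_{n∈ℤ} is ε-subordinated to {Q_n}_{n∈ℤ} ⊆ I_ε. If limsup_{n→+∞} min{p^u_n, p^s_n} > 0 and limsup_{n→−∞} min{p^u_n, p^s_n} > 0, then p^u_n = Q_n for infinitely many n > 0 and for infinitely many n < 0, and likewise p^s_n = Q_n for infinitely many n > 0 and for infinitely many n < 0. -/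
open Filter Topology

theorem Ieps_le_one {ε x : ℝ} (hε : 0 < ε) (hx : x ∈ Ieps ε) : x ≤ 1 := by
  obtain ⟨l, rfl⟩ := hx
  rw [Real.exp_le_one_iff]
  have : 0 ≤ (l : ℝ) * ε := by positivity
  linarith

/-- A bounded positive sequence growing by a factor `e ^ ε` unless it is truncated by `Q`
is truncated infinitely often in the future. -/
theorem infinite_pos_eq_of_min_recurrence {ε : ℝ} (hε : 0 < ε) {Q p : ℤ → ℝ}
    (hpos : ∀ n, 0 < p n) (hle : ∀ n, p n ≤ 1)
    (hrec : ∀ n, p (n + 1) = min (Real.exp ε * p n) (Q (n + 1))) :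
    {n : ℤ | 0 < n ∧ p n = Q n}.Infinite := by
  intro hfin
  obtain ⟨B, hB⟩ := hfin.bddAbove
  set M : ℤ := max B 0
  have hne : ∀ n, M < n → p n ≠ Q n := fun n hn h =>
    absurd (hB ⟨(le_max_right B 0).trans_lt hn, h⟩)
      (not_le.mpr ((le_max_left B 0).trans_lt hn))
  have hgrow : ∀ k : ℕ, p (M + k) = Real.exp (k * ε) * p M := by
    intro k
    induction k with
    | zero => simp
    | succ k ih =>
      have hstep : p (M + k + 1) = Real.exp ε * p (M + k) := by
        rcases min_choice (Real.exp ε * p (M + k)) (Q (M + k + 1)) with h | h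
        · rw [hrec, h]
        · exact absurd ((hrec _).trans h) (hne _ (by lia))
      have hexp : Real.exp ((k + 1 : ℕ) * ε) = Real.exp ε * Real.exp (k * ε) := by
        rw [← Real.exp_add]
        push_cast
        ring_nf
      rw [Nat.cast_succ, ← add_assoc, hstep, ih, hexp, mul_assoc]
  obtain ⟨k, hk⟩ := exists_nat_gt (1 / (ε * p M))
  have hM := hpos M
  rw [div_lt_iff₀ (by positivity)] at hk
  have hexp := mul_le_mul_of_nonneg_right (Real.add_one_le_exp (k * ε)) hM.le
  have := hle (M + k)
  rw [hgrow k] at this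
  nlinarith

/-- A sequence growing by a factor `e ^ ε` unless it is truncated by `Q`
is truncated infinitely often in the past, unless it tends to zero there. -/
theorem infinite_neg_eq_of_min_recurrence {ε : ℝ} (hε : 0 < ε) {Q p : ℤ → ℝ}
    (hrec : ∀ n, p (n + 1) = min (Real.exp ε * p n) (Q (n + 1)))
    (hlim : ¬ Tendsto p atBot (𝓝 0)) :
    {n : ℤ | n < 0 ∧ p n = Q n}.Infinite := by
  intro hfin
  apply hlim
  obtain ⟨B, hB⟩ := hfin.bddBelow
  set M : ℤ := min B 0 - 1
  have hne : ∀ n, n ≤ M → p n ≠ Q n := fun n hn h =>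
    absurd (hB ⟨by lia, h⟩) (by lia)
  have hdecay : ∀ k : ℕ, p (M - k) = Real.exp (-(k * ε)) * p M := by
    intro k
    induction k with
    | zero => simp
    | succ k ih =>
      have heq : M - (k + 1 : ℕ) + 1 = M - k := by
        push_cast
        ring
      have hstep : p (M - k) = Real.exp ε * p (M - (k + 1 : ℕ)) := by
        have hr := hrec (M - (k + 1 : ℕ))
        rw [heq] at hr
        rcases min_choice (Real.exp ε * p (M - (k + 1 : ℕ))) (Q (M - k)) with h | h
        · rw [hr, h]
        · exact absurd (hr.trans h) (hne _ (by lia))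
      have hexp : Real.exp (-(k * ε)) = Real.exp ε * Real.exp (-((k + 1 : ℕ) * ε)) := by
        rw [← Real.exp_add]
        push_cast
        ring_nf
      rw [hstep, hexp, mul_assoc] at ih
      exact mul_left_cancel₀ (Real.exp_pos ε).ne' ih
  have hexp : Tendsto (fun n : ℤ => Real.exp (((n : ℝ) - M) * ε) * p M) atBot (𝓝 0) := by
    have hbot : Tendsto (fun n : ℤ => ((n : ℝ) - M) * ε) atBot atBot :=
      (tendsto_atBot_add_const_right _ (-(M : ℝ)) (tendsto_intCast_atBot_iff.mpr tendsto_id)).atBot_mul_const hε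
    simpa using (Real.tendsto_exp_atBot.comp hbot).mul_const (p M)
  refine hexp.congr' ?_
  filter_upwards [eventually_le_atBot M] with n hn
  obtain ⟨k, hk⟩ := Int.eq_ofNat_of_zero_le (sub_nonneg.mpr hn)
  obtain rfl : n = M - k := by lia
  rw [hdecay]
  push_cast
  ring_nf

/-- Second Subordination Lemma. -/
theorem stmt3 (ε : ℝ) (hε : 0 < ε) (Q pu ps : ℤ → ℝ)
    (hQI : ∀ n, Q n ∈ Ieps ε) (hsub : Subordinated ε Q pu ps)
    (h1 : 0 < Filter.limsup (fun n : ℤ => min (pu n) (ps n)) Filter.atTop)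
    (h2 : 0 < Filter.limsup (fun n : ℤ => min (pu n) (ps n)) Filter.atBot) :
    {n : ℤ | 0 < n ∧ pu n = Q n}.Infinite ∧ {n : ℤ | n < 0 ∧ pu n = Q n}.Infinite ∧
    {n : ℤ | 0 < n ∧ ps n = Q n}.Infinite ∧ {n : ℤ | n < 0 ∧ ps n = Q n}.Infinite := by
  have hpu n : 0 < pu n := (hsub n).1.1
  have hps n : 0 < ps n := (hsub n).1.2
  have hpu_le n : pu n ≤ 1 := Ieps_le_one hε (hsub n).2.2.1.1
  have hps_le n : ps n ≤ 1 := Ieps_le_one hε (hsub n).2.2.1.2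
  have hpu_rec n : pu (n + 1) = min (Real.exp ε * pu n) (Q (n + 1)) := (hsub n).2.2.2.1
  have hps_rec n : ps (-(n + 1)) = min (Real.exp ε * ps (-n)) (Q (-(n + 1))) := by
    rw [neg_add']
    exact (hsub (-n)).2.2.2.2
  have hpu_lim : ¬ Tendsto pu atBot (𝓝 0) := fun h => h2.ne'
    (squeeze_zero (fun n => (lt_min (hpu n) (hps n)).le) (fun n => min_le_left _ _) h).limsup_eq
  have hps_lim : ¬ Tendsto (fun n => ps (-n)) atBot (𝓝 0) := fun h => h1.ne'
    (squeeze_zero (fun n => (lt_min (hpu n) (hps n)).le) (fun n => min_le_right _ _)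
      (by simpa [Function.comp_def] using h.comp tendsto_neg_atTop_atBot)).limsup_eq
  refine ⟨infinite_pos_eq_of_min_recurrence hε hpu hpu_le hpu_rec,
    infinite_neg_eq_of_min_recurrence hε hpu_rec hpu_lim, ?_, ?_⟩
  · refine Set.Infinite.mono ?_ ((infinite_neg_eq_of_min_recurrence (Q := fun n => Q (-n)) hε
      hps_rec hps_lim).image neg_injective.injOn)
    rintro _ ⟨n, ⟨hn, h⟩, rfl⟩
    exact ⟨neg_pos.mpr hn, h⟩
  · refine Set.Infinite.mono ?_ ((infinite_pos_eq_of_min_recurrence (Q := fun n => Q (-n)) hε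
      (fun n => hps (-n)) (fun n => hps_le (-n)) hps_rec).image neg_injective.injOn)
    rintro _ ⟨n, ⟨hn, h⟩, rfl⟩
    exact ⟨neg_neg_iff_pos.mpr hn, h⟩
end

section
/- Let Σ be a topological Markov shift and let r: Σ → (0,∞) be Hölder continuous and bounded away from zero and infinity. Then the Bowen–Walters distance d_r is a metric on Σ_r. -/
/-- The topological Markov shift: bi-infinite paths of the directed graph with
vertex set `V` and edge relation `E`. -/
abbrev TMS (V : Type) (E : V → V → Prop) : Type :=
  {x : ℤ → V // ∀ i : ℤ, E (x i) (x (i + 1))}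

/-- The `n`-th power of the left shift map (`n ∈ ℤ`); `shiftZ 1` is the left shift `σ`. -/
def shiftZ {V : Type} {E : V → V → Prop} (n : ℤ) (x : TMS V E) : TMS V E :=
  ⟨fun i => x.1 (i + n), fun i => by
    have h := x.2 (i + n)
    have e : i + n + 1 = i + 1 + n := by ring
    rw [e] at h
    exact h⟩

open Classical in
/-- The metric `d(u,v) = exp (-min {|n| : uₙ ≠ vₙ})` on the topological Markov shift. -/
noncomputable def tmsDist {V : Type} {E : V → V → Prop} (x y : TMS V E) : ℝ :=
  if x = y then 0
  else Real.exp (-((sInf {k : ℕ | ∃ n : ℤ, n.natAbs = k ∧ x.1 n ≠ y.1 n} : ℕ) : ℝ))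

/-- The unit suspension space `Σ_1 = {(x,t) : x ∈ Σ, 0 ≤ t < 1}`. -/
def Sigma1 (V : Type) (E : V → V → Prop) : Type :=
  {p : TMS V E × ℝ // 0 ≤ p.2 ∧ p.2 < 1}

/-- The suspension flow `ψ^τ (x,t) = (σ^n x, t + τ - n)` for the unique `n ∈ ℤ` with
`0 ≤ t + τ - n < 1`, namely `n = ⌊t + τ⌋`. -/
noncomputable def susp {V : Type} {E : V → V → Prop} (τ : ℝ) (z : Sigma1 V E) :
    Sigma1 V E :=
  ⟨(shiftZ ⌊z.1.2 + τ⌋ z.1.1, Int.fract (z.1.2 + τ)),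
    Int.fract_nonneg _, Int.fract_lt_one _⟩

/-- Length of the horizontal segment `[z,w]_h` (for `z, w` of the same height `t`):
`(1-t)·d(x,y) + t·d(σx, σy)`. -/
noncomputable def hlen {V : Type} {E : V → V → Prop} (z w : Sigma1 V E) : ℝ :=
  (1 - z.1.2) * tmsDist z.1.1 w.1.1 + z.1.2 * tmsDist (shiftZ 1 z.1.1) (shiftZ 1 w.1.1)

/-- Length of the vertical segment `[z,w]_v`: `inf {|t| : w = ψ^t z}`. -/
noncomputable def vlen {V : Type} {E : V → V → Prop} (z w : Sigma1 V E) : ℝ :=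
  sInf {c : ℝ | ∃ t : ℝ, susp t z = w ∧ c = |t|}

/-- Admissible costs of a single step of a basic path from `z` to `w`: either `z, w`
form a horizontal segment (same height) of length `hlen z w`, or a vertical segment
(`w = ψ^t z` for some `t`) of length `vlen z w`. -/
def stepCost {V : Type} {E : V → V → Prop} (z w : Sigma1 V E) : Set ℝ :=
  {c | (z.1.2 = w.1.2 ∧ c = hlen z w) ∨ ((∃ t : ℝ, susp t z = w) ∧ c = vlen z w)}

/-- The set of lengths of basic paths from `z` to `w`. -/
def pathCosts {V : Type} {E : V → V → Prop} (z w : Sigma1 V E) : Set ℝ :=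
  {c | ∃ (n : ℕ) (zs : ℕ → Sigma1 V E) (cs : ℕ → ℝ),
    zs 0 = z ∧ zs n = w ∧ (∀ i < n, cs i ∈ stepCost (zs i) (zs (i + 1))) ∧
    c = ∑ i ∈ Finset.range n, cs i}

/-- The Bowen–Walters metric on `Σ_1`: infimum of lengths of basic paths. -/
noncomputable def d1 {V : Type} {E : V → V → Prop} (z w : Sigma1 V E) : ℝ :=
  sInf (pathCosts z w)

/-- The phase space `Σ_r = {(x,t) : x ∈ Σ, 0 ≤ t < r(x)}` of the topological Markov flow. -/
def SigmaR (V : Type) (E : V → V → Prop) (r : TMS V E → ℝ) : Type :=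
  {p : TMS V E × ℝ // 0 ≤ p.2 ∧ p.2 < r p.1}

open Classical in
/-- The canonical bijection `ϑ_r : Σ_r → Σ_1`, `ϑ_r(x,t) = (x, t/r(x))`
(junk value if `r(x) ≤ 0`). -/
noncomputable def thetaR {V : Type} {E : V → V → Prop} (r : TMS V E → ℝ)
    (z : SigmaR V E r) : Sigma1 V E :=
  if h : 0 < r z.1.1 then
    ⟨(z.1.1, z.1.2 / r z.1.1), div_nonneg z.2.1 h.le, (div_lt_one h).2 z.2.2⟩
  else ⟨(z.1.1, 0), le_refl 0, zero_lt_one⟩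

/-- The Bowen–Walters distance on `Σ_r`: `d_r(z,w) = d_1(ϑ_r z, ϑ_r w)`. -/
noncomputable def dr {V : Type} {E : V → V → Prop} (r : TMS V E → ℝ)
    (z w : SigmaR V E r) : ℝ :=
  d1 (thetaR r z) (thetaR r w)

section Suspension

variable {V : Type} {E : V → V → Prop}

theorem shiftZ_zero (x : TMS V E) : shiftZ 0 x = x := by
  apply Subtype.ext
  funext i
  simp [shiftZ]

theorem shiftZ_shiftZ (m n : ℤ) (x : TMS V E) : shiftZ m (shiftZ n x) = shiftZ (m + n) x := by
  apply Subtype.ext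
  funext i
  simp [shiftZ, add_assoc]

theorem tmsDist_nonneg (x y : TMS V E) : 0 ≤ tmsDist x y := by
  unfold tmsDist
  split_ifs
  · exact le_rfl
  · positivity

theorem tmsDist_comm (x y : TMS V E) : tmsDist x y = tmsDist y x := by
  rcases eq_or_ne x y with rfl | h
  · rfl
  · simp only [tmsDist, if_neg h, if_neg h.symm, @ne_comm _ (x.1 _)]

theorem exp_neg_natAbs_le_tmsDist {x y : TMS V E} {m : ℤ} (h : x.1 m ≠ y.1 m) :
    Real.exp (-(m.natAbs : ℝ)) ≤ tmsDist x y := by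
  have hxy : x ≠ y := fun e => h (by rw [e])
  have hle : sInf {k : ℕ | ∃ n : ℤ, n.natAbs = k ∧ x.1 n ≠ y.1 n} ≤ m.natAbs :=
    Nat.sInf_le ⟨m, rfl, h⟩
  rw [tmsDist, if_neg hxy]
  exact Real.exp_le_exp.2 (neg_le_neg (Nat.cast_le.2 hle))

theorem Sigma1.ext {z w : Sigma1 V E} (hx : z.1.1 = w.1.1) (ht : z.1.2 = w.1.2) : z = w :=
  Subtype.ext (Prod.ext hx ht)

theorem susp_zero (z : Sigma1 V E) : susp 0 z = z := by
  apply Sigma1.ext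
  · simp [susp, Int.floor_eq_zero_iff.2 ⟨z.2.1, z.2.2⟩, shiftZ_zero]
  · simp [susp, Int.fract_eq_self.2 z.2]

theorem susp_susp (s t : ℝ) (z : Sigma1 V E) : susp s (susp t z) = susp (t + s) z := by
  have h : z.1.2 + (t + s) = Int.fract (z.1.2 + t) + s + (⌊z.1.2 + t⌋ : ℤ) := by
    have := Int.floor_add_fract (z.1.2 + t)
    linarith
  apply Sigma1.ext
  · simp only [susp, shiftZ_shiftZ, h, Int.floor_add_intCast]
  · simp only [susp, h, Int.fract_add_intCast]

theorem susp_neg_of_susp {t : ℝ} {z w : Sigma1 V E} (h : susp t z = w) : susp (-t) w = z := by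
  rw [← h, susp_susp, add_neg_cancel, susp_zero]

theorem hlen_nonneg (z w : Sigma1 V E) : 0 ≤ hlen z w :=
  add_nonneg (mul_nonneg (by linarith [z.2.2]) (tmsDist_nonneg _ _))
    (mul_nonneg z.2.1 (tmsDist_nonneg _ _))

theorem hlen_comm {z w : Sigma1 V E} (h : z.1.2 = w.1.2) : hlen z w = hlen w z := by
  rw [hlen, hlen, h, tmsDist_comm z.1.1, tmsDist_comm (shiftZ 1 z.1.1)]

theorem vlen_nonneg (z w : Sigma1 V E) : 0 ≤ vlen z w := by
  apply Real.sInf_nonneg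
  rintro c ⟨t, -, rfl⟩
  exact abs_nonneg t

theorem vlen_comm (z w : Sigma1 V E) : vlen z w = vlen w z := by
  have key : ∀ z w : Sigma1 V E, {c : ℝ | ∃ t : ℝ, susp t z = w ∧ c = |t|} ⊆
      {c : ℝ | ∃ t : ℝ, susp t w = z ∧ c = |t|} := by
    rintro z w c ⟨t, ht, rfl⟩
    exact ⟨-t, susp_neg_of_susp ht, (abs_neg t).symm⟩
  exact congrArg sInf (Set.Subset.antisymm (key z w) (key w z))

theorem stepCost_nonneg {z w : Sigma1 V E} {c : ℝ} (hc : c ∈ stepCost z w) : 0 ≤ c := by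
  rcases hc with ⟨-, rfl⟩ | ⟨-, rfl⟩
  · exact hlen_nonneg z w
  · exact vlen_nonneg z w

theorem stepCost_symm {z w : Sigma1 V E} {c : ℝ} (hc : c ∈ stepCost z w) : c ∈ stepCost w z := by
  rcases hc with ⟨h, rfl⟩ | ⟨⟨t, ht⟩, rfl⟩
  · exact Or.inl ⟨h.symm, hlen_comm h⟩
  · exact Or.inr ⟨⟨-t, susp_neg_of_susp ht⟩, vlen_comm z w⟩

theorem pathCosts_nonneg {z w : Sigma1 V E} {c : ℝ} (hc : c ∈ pathCosts z w) : 0 ≤ c := by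
  obtain ⟨n, zs, cs, -, -, hs, rfl⟩ := hc
  exact Finset.sum_nonneg fun i hi => stepCost_nonneg (hs i (Finset.mem_range.1 hi))

theorem bddBelow_pathCosts (z w : Sigma1 V E) : BddBelow (pathCosts z w) :=
  ⟨0, fun _ hc => pathCosts_nonneg hc⟩

theorem zero_mem_pathCosts (z : Sigma1 V E) : (0 : ℝ) ∈ pathCosts z z :=
  ⟨0, fun _ => z, fun _ => 0, rfl, rfl, by simp, by simp⟩

theorem pathCosts_of_stepCost {z w : Sigma1 V E} {c : ℝ} (hc : c ∈ stepCost z w) :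
    c ∈ pathCosts z w := by
  refine ⟨1, fun i => if i = 0 then z else w, fun _ => c, by simp, by simp, ?_, by simp⟩
  intro i hi
  obtain rfl : i = 0 := by omega
  simpa using hc

theorem pathCosts_add {z u w : Sigma1 V E} {c c' : ℝ} (hc : c ∈ pathCosts z u)
    (hc' : c' ∈ pathCosts u w) : c + c' ∈ pathCosts z w := by
  obtain ⟨n, zs, cs, h0, hn, hs, rfl⟩ := hc
  obtain ⟨m, zs', cs', h0', hm, hs', rfl⟩ := hc'
  refine ⟨n + m, fun i => if i ≤ n then zs i else zs' (i - n),
    fun i => if i < n then cs i else cs' (i - n), by simpa using h0, ?_, ?_, ?_⟩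
  · rcases Nat.eq_zero_or_pos m with rfl | hpos
    · simp [hn, ← hm, h0']
    · simp [hpos.ne', hm]
  · intro i hi
    rcases lt_or_ge i n with h | h
    · simpa [h, h.le, Nat.succ_le_iff] using hs i h
    · have e : i + 1 - n = (i - n) + 1 := by omega
      have hstep := hs' (i - n) (by omega)
      rcases h.eq_or_lt with rfl | h'
      · simpa [hn, h0'] using hstep
      · simpa [h'.not_ge, h.not_gt, e, show ¬ i + 1 ≤ n by omega] using hstep
  · rw [Finset.sum_range_add]
    congr 1
    · exact Finset.sum_congr rfl fun i hi => by simp [Finset.mem_range.1 hi]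
    · simp

theorem pathCosts_symm {z w : Sigma1 V E} {c : ℝ} (hc : c ∈ pathCosts z w) :
    c ∈ pathCosts w z := by
  obtain ⟨n, zs, cs, h0, hn, hs, rfl⟩ := hc
  refine ⟨n, fun i => zs (n - i), fun i => cs (n - 1 - i), by simpa using hn, by simpa using h0,
    ?_, (Finset.sum_range_reflect cs n).symm⟩
  intro i hi
  have h := stepCost_symm (hs (n - 1 - i) (by omega))
  rw [show n - 1 - i + 1 = n - i by omega] at h
  have e : n - (i + 1) = n - 1 - i := by omega
  simpa only [e] using h

theorem pathCosts_nonempty (z w : Sigma1 V E) : (pathCosts z w).Nonempty := by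
  let u := susp (w.1.2 - z.1.2) z
  have hu : u.1.2 = w.1.2 := by
    simp [u, susp, Int.fract_eq_self.2 w.2]
  exact ⟨_, pathCosts_add (pathCosts_of_stepCost (w := u) (Or.inr ⟨⟨_, rfl⟩, rfl⟩))
    (pathCosts_of_stepCost (Or.inl ⟨hu, rfl⟩))⟩

theorem d1_nonneg (z w : Sigma1 V E) : 0 ≤ d1 z w :=
  Real.sInf_nonneg fun _ hc => pathCosts_nonneg hc

theorem d1_self (z : Sigma1 V E) : d1 z z = 0 :=
  le_antisymm (csInf_le (bddBelow_pathCosts z z) (zero_mem_pathCosts z)) (d1_nonneg z z)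

theorem d1_comm (z w : Sigma1 V E) : d1 z w = d1 w z :=
  congrArg sInf (Set.Subset.antisymm (fun _ => pathCosts_symm) (fun _ => pathCosts_symm))

theorem d1_triangle (z u w : Sigma1 V E) : d1 z w ≤ d1 z u + d1 u w := by
  rw [← sub_le_iff_le_add]
  refine le_csInf (pathCosts_nonempty z u) fun c hc => ?_
  rw [sub_le_comm]
  refine le_csInf (pathCosts_nonempty u w) fun c' hc' => ?_
  rw [sub_le_iff_le_add']
  exact csInf_le (bddBelow_pathCosts z w) (pathCosts_add hc hc')

/-- A function that is Lipschitz along horizontal and vertical segments takes equal values at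
points of zero Bowen–Walters distance. -/
theorem eq_of_d1_eq_zero {F : Sigma1 V E → ℝ} {L K : ℝ} (hL : 0 ≤ L) (hK : 0 ≤ K)
    (hh : ∀ z w : Sigma1 V E, z.1.2 = w.1.2 → |F z - F w| ≤ L * hlen z w)
    (hv : ∀ (z : Sigma1 V E) (t : ℝ), |F z - F (susp t z)| ≤ K * |t|)
    {z w : Sigma1 V E} (h : d1 z w = 0) : F z = F w := by
  have hstep : ∀ {z w : Sigma1 V E} {c : ℝ}, c ∈ stepCost z w → |F z - F w| ≤ (L + K + 1) * c := by
    intro z w c hc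
    have hc0 := stepCost_nonneg hc
    rcases hc with ⟨h, rfl⟩ | ⟨⟨t, ht⟩, rfl⟩
    · nlinarith [hh z w h]
    · have : |F z - F w| / (L + K + 1) ≤ vlen z w := by
        refine le_csInf ⟨_, t, ht, rfl⟩ ?_
        rintro c ⟨s, hs, rfl⟩
        rw [div_le_iff₀ (by positivity)]
        have := hv z s
        rw [hs] at this
        nlinarith [abs_nonneg s]
      rwa [div_le_iff₀' (by positivity)] at this
  have hpath : |F z - F w| / (L + K + 1) ≤ d1 z w := by
    refine le_csInf (pathCosts_nonempty z w) ?_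
    rintro c ⟨n, zs, cs, rfl, rfl, hs, rfl⟩
    rw [div_le_iff₀' (by positivity), Finset.mul_sum, ← Real.dist_eq]
    exact (dist_le_range_sum_dist (fun i => F (zs i)) n).trans
      (Finset.sum_le_sum fun i hi => hstep (hs i (Finset.mem_range.1 hi)))
  rw [h, div_le_iff₀ (by positivity), zero_mul] at hpath
  exact sub_eq_zero.1 (abs_nonpos_iff.1 hpath)

/-- A function on `Σ × [0,1]` that is Lipschitz in the height and compatible with the
identification `(x,1) ∼ (σ x,0)` is Lipschitz along the suspension flow. -/
theorem abs_sub_susp_le {A : TMS V E → ℝ → ℝ} {K : ℝ} (hA : ∀ x, A x 1 = A (shiftZ 1 x) 0)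
    (hK : ∀ x, ∀ s ∈ Set.Icc (0 : ℝ) 1, ∀ t ∈ Set.Icc (0 : ℝ) 1, |A x s - A x t| ≤ K * |s - t|)
    (z : Sigma1 V E) (τ : ℝ) :
    |A z.1.1 z.1.2 - A (susp τ z).1.1 (susp τ z).1.2| ≤ K * |τ| := by
  have hn : ∀ (n : ℕ) (x : TMS V E), |A x 0 - A (shiftZ n x) 0| ≤ K * n := by
    intro n x
    induction n with
    | zero => simp [shiftZ_zero]
    | succ n ih =>
      have h1 := hK (shiftZ n x) 0 (by simp) 1 (by simp)
      rw [hA, shiftZ_shiftZ, add_comm (1 : ℤ)] at h1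
      norm_num at h1
      have := abs_sub_le (A x 0) (A (shiftZ n x) 0) (A (shiftZ (n + 1) x) 0)
      push_cast
      linarith
  have hpos : ∀ (z : Sigma1 V E) (τ : ℝ), 0 ≤ τ →
      |A z.1.1 z.1.2 - A (susp τ z).1.1 (susp τ z).1.2| ≤ K * τ := by
    intro z τ hτ
    obtain ⟨⟨x, t⟩, ht0, ht1⟩ := z
    simp only [susp] at ht0 ht1 ⊢
    have hf0 := Int.fract_nonneg (t + τ)
    have hf1 := (Int.fract_lt_one (t + τ)).le
    have hfl := Int.floor_add_fract (t + τ)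
    obtain ⟨n, hfn⟩ := Int.eq_ofNat_of_zero_le (Int.floor_nonneg.2 (add_nonneg ht0 hτ))
    rw [hfn] at hfl ⊢
    generalize Int.fract (t + τ) = f at *
    cases n with
    | zero =>
      have e : f - t = τ := by simp at hfl; linarith
      have := hK x t ⟨ht0, ht1.le⟩ f ⟨hf0, hf1⟩
      rw [abs_sub_comm t f, e, abs_of_nonneg hτ] at this
      rwa [Nat.cast_zero, shiftZ_zero]
    | succ n =>
      have h1 := hK x t ⟨ht0, ht1.le⟩ 1 (by simp)
      have h2 := hn n (shiftZ 1 x)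
      have h3 := hK (shiftZ (n + 1) x) 0 (by simp) f ⟨hf0, hf1⟩
      rw [hA, abs_sub_comm t 1, abs_of_nonneg (by linarith : 0 ≤ 1 - t)] at h1
      rw [shiftZ_shiftZ] at h2
      rw [zero_sub, abs_neg, abs_of_nonneg hf0] at h3
      push_cast at hfl ⊢
      have e : τ = (1 - t) + n + f := by linarith
      rw [e, mul_add, mul_add]
      have h4 := abs_sub_le (A x t) (A (shiftZ 1 x) 0) (A (shiftZ (n + 1) x) f)
      have h5 := abs_sub_le (A (shiftZ 1 x) 0) (A (shiftZ (n + 1) x) 0) (A (shiftZ (n + 1) x) f)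
      linarith
  rcases le_total 0 τ with h | h
  · rw [abs_of_nonneg h]
    exact hpos z τ h
  · have := hpos (susp τ z) (-τ) (by linarith)
    rw [susp_neg_of_susp rfl] at this
    rwa [abs_of_nonpos h, abs_sub_comm]

theorem weighted_eq_of_d1_eq_zero {p q : ℝ → ℝ} {g : TMS V E → ℝ} {K L : ℝ} (hK : 0 ≤ K)
    (hL : 0 ≤ L) (hg : ∀ x, |g x| ≤ 1) (hgL : ∀ x y, |g x - g y| ≤ L * tmsDist x y)
    (hp : ∀ s ∈ Set.Icc (0 : ℝ) 1, ∀ t ∈ Set.Icc (0 : ℝ) 1, |p s - p t| ≤ K * |s - t|)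
    (hq : ∀ s ∈ Set.Icc (0 : ℝ) 1, ∀ t ∈ Set.Icc (0 : ℝ) 1, |q s - q t| ≤ K * |s - t|)
    (hp1 : p 1 = 0) (hq0 : q 0 = 0) (hpq : q 1 = p 0) {z w : Sigma1 V E} (h : d1 z w = 0) :
    p z.1.2 * g z.1.1 + q z.1.2 * g (shiftZ 1 z.1.1) =
      p w.1.2 * g w.1.1 + q w.1.2 * g (shiftZ 1 w.1.1) := by
  let A : TMS V E → ℝ → ℝ := fun x t => p t * g x + q t * g (shiftZ 1 x)
  refine eq_of_d1_eq_zero (F := fun z => A z.1.1 z.1.2) (mul_nonneg hK hL)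
    (by positivity : 0 ≤ K + K) ?_ ?_ h
  · intro z w ht
    have ht0 := z.2.1
    have ht1 := z.2.2
    have hpt := hp z.1.2 ⟨ht0, ht1.le⟩ 1 (by simp)
    have hqt := hq z.1.2 ⟨ht0, ht1.le⟩ 0 (by simp)
    rw [hp1, sub_zero, abs_sub_comm, abs_of_nonneg (by linarith : 0 ≤ 1 - z.1.2)] at hpt
    rw [hq0, sub_zero, sub_zero, abs_of_nonneg ht0] at hqt
    have e : A z.1.1 z.1.2 - A w.1.1 w.1.2 = p z.1.2 * (g z.1.1 - g w.1.1) +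
        q z.1.2 * (g (shiftZ 1 z.1.1) - g (shiftZ 1 w.1.1)) := by
      simp only [A, ← ht]
      ring
    calc |A z.1.1 z.1.2 - A w.1.1 w.1.2|
        ≤ |p z.1.2| * |g z.1.1 - g w.1.1| +
          |q z.1.2| * |g (shiftZ 1 z.1.1) - g (shiftZ 1 w.1.1)| := by
          rw [e, ← abs_mul, ← abs_mul]
          exact abs_add_le _ _
      _ ≤ (K * (1 - z.1.2)) * (L * tmsDist z.1.1 w.1.1) +
          (K * z.1.2) * (L * tmsDist (shiftZ 1 z.1.1) (shiftZ 1 w.1.1)) := by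
          have h0 : 0 ≤ 1 - z.1.2 := by linarith
          gcongr
          · exact hgL _ _
          · exact hgL _ _
      _ = K * L * hlen z w := by
          rw [hlen]
          ring
  · apply abs_sub_susp_le
    · intro x
      simp [A, hp1, hq0, hpq]
    · intro x s hs t ht
      have e : A x s - A x t = (p s - p t) * g x + (q s - q t) * g (shiftZ 1 x) := by
        simp only [A]
        ring
      calc |A x s - A x t| ≤ |p s - p t| * |g x| + |q s - q t| * |g (shiftZ 1 x)| := by
            rw [e, ← abs_mul, ← abs_mul]
            exact abs_add_le _ _
        _ ≤ (K * |s - t|) * 1 + (K * |s - t|) * 1 := by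
            gcongr
            · exact hp s hs t ht
            · exact hg _
            · exact hq s hs t ht
            · exact hg _
        _ = (K + K) * |s - t| := by ring

theorem abs_mul_one_sub_sub_le {s t : ℝ} (hs : s ∈ Set.Icc (0 : ℝ) 1)
    (ht : t ∈ Set.Icc (0 : ℝ) 1) : |s * (1 - s) - t * (1 - t)| ≤ 3 * |s - t| := by
  rw [show s * (1 - s) - t * (1 - t) = (1 - s - t) * (s - t) by ring, abs_mul]
  gcongr
  rw [abs_le]
  constructor <;> linarith [hs.1, hs.2, ht.1, ht.2]

theorem abs_sq_mul_one_sub_sub_le {s t : ℝ} (hs : s ∈ Set.Icc (0 : ℝ) 1)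
    (ht : t ∈ Set.Icc (0 : ℝ) 1) : |s ^ 2 * (1 - s) - t ^ 2 * (1 - t)| ≤ 3 * |s - t| := by
  rw [show s ^ 2 * (1 - s) - t ^ 2 * (1 - t) =
    (s + t - (s ^ 2 + s * t + t ^ 2)) * (s - t) by ring, abs_mul]
  gcongr
  obtain ⟨hs0, hs1⟩ := hs
  obtain ⟨ht0, ht1⟩ := ht
  rw [abs_le]
  constructor <;> nlinarith [mul_nonneg hs0 ht0]

theorem eq_of_forall_indicator_eq {x y : TMS V E}
    (h : ∀ (m : ℤ) (v : V), Set.indicator {u : TMS V E | u.1 m = v} (1 : TMS V E → ℝ) x =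
      Set.indicator {u : TMS V E | u.1 m = v} (1 : TMS V E → ℝ) y) : x = y := by
  classical
  apply Subtype.ext
  funext m
  by_contra hne
  have := h m (x.1 m)
  rw [Set.indicator_of_mem (by simp), Set.indicator_of_notMem (by simpa using Ne.symm hne)] at this
  simp at this

theorem abs_indicator_sub_le (m : ℤ) (v : V) (x y : TMS V E) :
    |Set.indicator {u : TMS V E | u.1 m = v} (1 : TMS V E → ℝ) x -
      Set.indicator {u : TMS V E | u.1 m = v} (1 : TMS V E → ℝ) y| ≤
      Real.exp m.natAbs * tmsDist x y := by
  classical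
  by_cases hne : x.1 m = y.1 m
  · have e : Set.indicator {u : TMS V E | u.1 m = v} (1 : TMS V E → ℝ) x =
        Set.indicator {u : TMS V E | u.1 m = v} (1 : TMS V E → ℝ) y := by
      simp [Set.indicator_apply, hne]
    rw [e, sub_self, abs_zero]
    exact mul_nonneg (Real.exp_nonneg _) (tmsDist_nonneg x y)
  · have h1 : (1 : ℝ) ≤ Real.exp m.natAbs * tmsDist x y := by
      calc (1 : ℝ) = Real.exp m.natAbs * Real.exp (-(m.natAbs : ℝ)) := by
            rw [← Real.exp_add, add_neg_cancel, Real.exp_zero]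
        _ ≤ _ := by
            gcongr
            exact exp_neg_natAbs_le_tmsDist hne
    refine le_trans ?_ h1
    simp only [Set.indicator_apply, Pi.one_apply]
    split_ifs <;> norm_num

theorem sigma1_eq_of_d1_eq_zero {z w : Sigma1 V E} (h : d1 z w = 0) : z = w := by
  have hone : ∀ x : TMS V E, |(fun _ => (1 : ℝ)) x| ≤ 1 := by simp
  have honeL : ∀ x y : TMS V E,
      |(fun _ : TMS V E => (1 : ℝ)) x - (fun _ : TMS V E => (1 : ℝ)) y| ≤ 0 * tmsDist x y := by
    simp
  have hzero : ∀ s ∈ Set.Icc (0 : ℝ) 1, ∀ t ∈ Set.Icc (0 : ℝ) 1,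
      |(fun _ : ℝ => (0 : ℝ)) s - (fun _ : ℝ => (0 : ℝ)) t| ≤ 3 * |s - t| := by
    intro s _ t _
    simp
  have hquad := weighted_eq_of_d1_eq_zero (by norm_num) le_rfl hone honeL
    (p := fun t => t * (1 - t)) (fun s hs t ht => abs_mul_one_sub_sub_le hs ht) hzero
    (by simp) rfl (by simp) h
  have hcub := weighted_eq_of_d1_eq_zero (by norm_num) le_rfl hone honeL
    (p := fun t => t ^ 2 * (1 - t)) (fun s hs t ht => abs_sq_mul_one_sub_sub_le hs ht) hzero
    (by simp) rfl (by simp) h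
  simp only [mul_one, add_zero] at hquad hcub
  have hz0 := z.2.1
  have hz1 := z.2.2
  have hw0 := w.2.1
  have hw1 := w.2.2
  have ht : z.1.2 = w.1.2 := by
    have hmul : (z.1.2 - w.1.2) * (z.1.2 * (1 - z.1.2)) = 0 := by
      linear_combination hcub - w.1.2 * hquad
    rcases mul_eq_zero.1 hmul with h' | h'
    · linarith
    · rw [h', eq_comm, mul_eq_zero] at hquad
      rcases mul_eq_zero.1 h' with h1 | h1 <;> rcases hquad with h2 | h2 <;> linarith
  refine Sigma1.ext (eq_of_forall_indicator_eq fun m v => ?_) ht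
  have hind : ∀ x : TMS V E,
      |Set.indicator {u : TMS V E | u.1 m = v} (1 : TMS V E → ℝ) x| ≤ 1 := by
    classical
    intro x
    simp only [Set.indicator_apply, Pi.one_apply]
    split_ifs <;> norm_num
  rcases hz0.eq_or_lt with h0 | h0
  · have := weighted_eq_of_d1_eq_zero (p := fun t => 1 - t) (q := fun t => t) zero_le_one
      (Real.exp_nonneg _) hind (abs_indicator_sub_le m v)
      (fun s _ t _ => by rw [one_mul, abs_sub_comm s t]; apply le_of_eq; congr 1; ring)
      (fun s _ t _ => by rw [one_mul]) (by simp) rfl (by simp) h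
    simpa [← ht, ← h0] using this
  · have := weighted_eq_of_d1_eq_zero (by norm_num) (Real.exp_nonneg _) hind
      (abs_indicator_sub_le m v) (p := fun t => t * (1 - t))
      (fun s hs t ht => abs_mul_one_sub_sub_le hs ht) hzero (by simp) rfl (by simp) h
    simp only [zero_mul, add_zero, ← ht] at this
    exact mul_left_cancel₀ (mul_pos h0 (by linarith)).ne' this

theorem thetaR_val {r : TMS V E → ℝ} {z : SigmaR V E r} (h : 0 < r z.1.1) :
    (thetaR r z).1 = (z.1.1, z.1.2 / r z.1.1) :=
  congrArg Subtype.val (dif_pos h)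

theorem thetaR_injective {r : TMS V E → ℝ} (hr : ∀ x, 0 < r x) :
    Function.Injective (thetaR r) := by
  intro z w h
  replace h := congrArg Subtype.val h
  rw [thetaR_val (hr _), thetaR_val (hr _), Prod.mk.injEq] at h
  obtain ⟨hx, ht⟩ := h
  rw [hx, div_left_inj' (hr _).ne'] at ht
  exact Subtype.ext (Prod.ext hx ht)

end Suspension

/-- the Bowen–Walters distance `d_r` is a metric on `Σ_r`. -/
theorem stmt14 (V : Type) (E : V → V → Prop)
    (hin : ∀ v, ∃ u, E u v) (hout : ∀ v, ∃ w, E v w)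
    (r : TMS V E → ℝ) (a b H α : ℝ) (ha : 0 < a) (hab : ∀ x, a ≤ r x ∧ r x ≤ b)
    (hH : 0 < H) (hα : 0 < α) (hα1 : α ≤ 1)
    (hHol : ∀ x y : TMS V E, |r x - r y| ≤ H * tmsDist x y ^ α) :
    (∀ z w : SigmaR V E r, 0 ≤ dr r z w) ∧
    (∀ z w : SigmaR V E r, dr r z w = 0 ↔ z = w) ∧
    (∀ z w : SigmaR V E r, dr r z w = dr r w z) ∧
    (∀ z u w : SigmaR V E r, dr r z w ≤ dr r z u + dr r u w) := by
  have hr : ∀ x, 0 < r x := fun x => ha.trans_le (hab x).1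
  refine ⟨fun _ _ => d1_nonneg _ _, fun z w => ⟨fun h => ?_, ?_⟩, fun _ _ => d1_comm _ _,
    fun _ _ _ => d1_triangle _ _ _⟩
  · exact thetaR_injective hr (sigma1_eq_of_d1_eq_zero h)
  · rintro rfl
    exact d1_self _
end

section
/- Let Σ be a topological Markov shift, let Σ_1 := {(x,t) : x ∈ Σ, 0 ≤ t < 1} carry the constant suspension flow ψ and the Bowen–Walters metric d_1. Then for all z, w ∈ Σ_1 and all τ ∈ ℝ with |τ| < 1: (1 + 2e²|τ|)^{−1}·d_1(z,w) ≤ d_1(ψ^τ(z), ψ^τ(w)) ≤ (1 + 2e²|τ|)·d_1(z,w). -/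
namespace TMS

variable {V : Type} {E : V → V → Prop}

theorem shiftZ_zero (x : TMS V E) : shiftZ 0 x = x :=
  Subtype.ext (funext fun i => congrArg x.1 (add_zero i))

theorem shiftZ_shiftZ (m n : ℤ) (x : TMS V E) :
    shiftZ m (shiftZ n x) = shiftZ (n + m) x :=
  Subtype.ext (funext fun i => congrArg x.1 (by ring))

theorem tmsDist_nonneg (x y : TMS V E) : 0 ≤ tmsDist x y := by
  unfold tmsDist
  split_ifs
  · exact le_rfl
  · exact (Real.exp_pos _).le

/-- A power `σ^n` of the shift with `|n| ≤ 1` is Lipschitz with constant `e`. -/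
theorem tmsDist_shiftZ_le (n : ℤ) (hn : n.natAbs ≤ 1) (x y : TMS V E) :
    tmsDist (shiftZ n x) (shiftZ n y) ≤ Real.exp 1 * tmsDist x y := by
  by_cases hs : shiftZ n x = shiftZ n y
  · rw [tmsDist, if_pos hs]
    exact mul_nonneg (Real.exp_pos _).le (tmsDist_nonneg x y)
  have hxy : x ≠ y := fun h => hs (h ▸ rfl)
  rw [tmsDist, if_neg hs, tmsDist, if_neg hxy, ← Real.exp_add, Real.exp_le_exp]
  set S := {k : ℕ | ∃ i : ℤ, i.natAbs = k ∧ (shiftZ n x).1 i ≠ (shiftZ n y).1 i}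
  set T := {k : ℕ | ∃ i : ℤ, i.natAbs = k ∧ x.1 i ≠ y.1 i}
  have hS : S.Nonempty := by
    by_contra h
    refine hs (Subtype.ext (funext fun i => ?_))
    by_contra hi
    exact h ⟨i.natAbs, i, rfl, hi⟩
  obtain ⟨i, hi, hne⟩ := Nat.sInf_mem hS
  have hT : sInf T ≤ (i + n).natAbs := Nat.sInf_le ⟨i + n, rfl, hne⟩
  have hle : sInf T ≤ sInf S + 1 := by omega
  have : ((sInf T : ℕ) : ℝ) ≤ ((sInf S : ℕ) : ℝ) + 1 := by exact_mod_cast hle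
  linarith

end TMS

/-- The linear interpolation of a nonnegative sequence whose consecutive ratios lie in
`[C⁻¹, C]` changes by a factor at most `1 + C² |τ|` over a time `|τ| < 1`. -/
theorem linear_interpolation_le {D : ℤ → ℝ} {C : ℝ} (hC : 1 ≤ C) (hD : ∀ n, 0 ≤ D n)
    (hup : ∀ n, D (n + 1) ≤ C * D n) (hdown : ∀ n, D n ≤ C * D (n + 1))
    {t τ : ℝ} (ht0 : 0 ≤ t) (ht1 : t < 1) (hτ : |τ| < 1) :
    (1 - Int.fract (t + τ)) * D ⌊t + τ⌋ + Int.fract (t + τ) * D (⌊t + τ⌋ + 1) ≤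
      (1 + C ^ 2 * |τ|) * ((1 - t) * D 0 + t * D 1) := by
  obtain ⟨hτl, hτr⟩ := abs_lt.1 hτ
  have hu0 : D 1 ≤ C * D 0 := by simpa using hup 0
  have hu1 : D 2 ≤ C * D 1 := by simpa using hup 1
  have hd0 : D 0 ≤ C * D 1 := by simpa using hdown 0
  have hd1 : D (-1) ≤ C * D 0 := by simpa using hdown (-1)
  have h0 := hD 0
  have h1 := hD 1
  set h := (1 - t) * D 0 + t * D 1 with hh
  have hD0 : D 0 ≤ C * h := by
    have : t * D 0 ≤ t * (C * D 1) := mul_le_mul_of_nonneg_left hd0 ht0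
    have : (1 - t) * D 0 ≤ (1 - t) * (C * D 0) :=
      mul_le_mul_of_nonneg_left (le_mul_of_one_le_left h0 hC) (by linarith)
    rw [hh]; linarith
  have hD1 : D 1 ≤ C * h := by
    have : t * D 1 ≤ t * (C * D 1) :=
      mul_le_mul_of_nonneg_left (le_mul_of_one_le_left h1 hC) ht0
    have : (1 - t) * D 1 ≤ (1 - t) * (C * D 0) :=
      mul_le_mul_of_nonneg_left hu0 (by linarith)
    rw [hh]; linarith
  have hhn : 0 ≤ h := add_nonneg (mul_nonneg (by linarith) h0) (mul_nonneg ht0 h1)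
  have hCC : C * h ≤ C ^ 2 * h :=
    mul_le_mul_of_nonneg_right (by nlinarith) hhn
  have hstep : C * (C * h) = C ^ 2 * h := by ring
  have hD2 : D 2 ≤ C ^ 2 * h :=
    hstep ▸ hu1.trans (mul_le_mul_of_nonneg_left hD1 (by linarith))
  have hDm : D (-1) ≤ C ^ 2 * h :=
    hstep ▸ hd1.trans (mul_le_mul_of_nonneg_left hD0 (by linarith))
  have hfr : Int.fract (t + τ) = t + τ - ⌊t + τ⌋ := rfl
  rw [hfr]
  rcases lt_or_ge (t + τ) 0 with hneg | hpos
  · have hfl : ⌊t + τ⌋ = -1 := Int.floor_eq_iff.2 ⟨by push_cast; linarith, by push_cast; linarith⟩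
    have hab : |τ| = -τ := abs_of_nonpos (by linarith)
    rw [hfl, hab, show (-1 : ℤ) + 1 = 0 from rfl]
    push_cast
    have e1 : -(t + τ) * (D (-1) - D 0) ≤ -(t + τ) * (C ^ 2 * h) :=
      mul_le_mul_of_nonneg_left (by linarith) (by linarith)
    have e2 : t * (D 0 - D 1) ≤ t * (C ^ 2 * h) :=
      mul_le_mul_of_nonneg_left (by linarith) ht0
    linarith
  rcases lt_or_ge (t + τ) 1 with hlt | hge
  · have hfl : ⌊t + τ⌋ = 0 := Int.floor_eq_iff.2 ⟨by push_cast; linarith, by push_cast; linarith⟩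
    rw [hfl, zero_add]
    push_cast
    have e1 : τ * (D 1 - D 0) ≤ |τ| * (C ^ 2 * h) := by
      refine (le_abs_self _).trans ?_
      rw [abs_mul]
      exact mul_le_mul_of_nonneg_left (abs_le.2 ⟨by linarith, by linarith⟩) (abs_nonneg τ)
    linarith
  · have hfl : ⌊t + τ⌋ = 1 := Int.floor_eq_iff.2 ⟨by push_cast; linarith, by push_cast; linarith⟩
    have hab : |τ| = τ := abs_of_nonneg (by linarith)
    rw [hfl, hab, show (1 : ℤ) + 1 = 2 from rfl]
    push_cast
    have e1 : (1 - t) * (D 1 - D 0) ≤ (1 - t) * (C ^ 2 * h) :=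
      mul_le_mul_of_nonneg_left (by linarith) (by linarith)
    have e2 : (t + τ - 1) * (D 2 - D 1) ≤ (t + τ - 1) * (C ^ 2 * h) :=
      mul_le_mul_of_nonneg_left (by linarith) (by linarith)
    linarith

namespace Sigma1

variable {V : Type} {E : V → V → Prop}

theorem susp_susp (s t : ℝ) (z : Sigma1 V E) : susp s (susp t z) = susp (t + s) z := by
  have hsum : Int.fract (z.1.2 + t) + s = z.1.2 + (t + s) - (⌊z.1.2 + t⌋ : ℝ) := by
    rw [Int.fract]; ring
  refine Subtype.ext (Prod.ext ?_ ?_)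
  · change shiftZ ⌊Int.fract (z.1.2 + t) + s⌋ (shiftZ ⌊z.1.2 + t⌋ z.1.1) = shiftZ _ z.1.1
    rw [TMS.shiftZ_shiftZ, hsum, Int.floor_sub_intCast, add_sub_cancel]
  · change Int.fract (Int.fract (z.1.2 + t) + s) = Int.fract (z.1.2 + (t + s))
    rw [hsum, Int.fract_sub_intCast]

theorem susp_zero (z : Sigma1 V E) : susp 0 z = z := by
  have hfl : ⌊z.1.2⌋ = 0 := Int.floor_eq_zero_iff.2 z.2
  refine Subtype.ext (Prod.ext ?_ ?_)
  · change shiftZ ⌊z.1.2 + 0⌋ z.1.1 = z.1.1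
    rw [add_zero, hfl, TMS.shiftZ_zero]
  · change Int.fract (z.1.2 + 0) = z.1.2
    rw [add_zero, Int.fract_eq_self.2 z.2]

theorem susp_neg_susp (τ : ℝ) (z : Sigma1 V E) : susp (-τ) (susp τ z) = z := by
  rw [susp_susp, add_neg_cancel, susp_zero]

theorem susp_susp_eq_iff (t τ : ℝ) (z w : Sigma1 V E) :
    susp t (susp τ z) = susp τ w ↔ susp t z = w := by
  rw [susp_susp, add_comm, ← susp_susp]
  exact (Function.LeftInverse.injective (susp_neg_susp τ)).eq_iff

theorem vlen_susp (τ : ℝ) (z w : Sigma1 V E) : vlen (susp τ z) (susp τ w) = vlen z w := by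
  simp only [vlen, susp_susp_eq_iff]

theorem vlen_nonneg (z w : Sigma1 V E) : 0 ≤ vlen z w := by
  refine Real.sInf_nonneg ?_
  rintro _ ⟨t, -, rfl⟩
  exact abs_nonneg t

theorem hlen_nonneg (z w : Sigma1 V E) : 0 ≤ hlen z w :=
  add_nonneg (mul_nonneg (by linarith [z.2.2]) (TMS.tmsDist_nonneg _ _))
    (mul_nonneg z.2.1 (TMS.tmsDist_nonneg _ _))

theorem hlen_susp_le {τ : ℝ} (hτ : |τ| < 1) {z w : Sigma1 V E} (h : z.1.2 = w.1.2) :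
    hlen (susp τ z) (susp τ w) ≤ (1 + Real.exp 1 ^ 2 * |τ|) * hlen z w := by
  have key := linear_interpolation_le
    (D := fun n => tmsDist (shiftZ n z.1.1) (shiftZ n w.1.1))
    (Real.one_le_exp zero_le_one) (fun _ => TMS.tmsDist_nonneg _ _)
    (fun n => by
      simpa only [TMS.shiftZ_shiftZ] using
        TMS.tmsDist_shiftZ_le 1 (by decide) (shiftZ n z.1.1) (shiftZ n w.1.1))
    (fun n => by
      simpa only [TMS.shiftZ_shiftZ, add_neg_cancel_right] using
        TMS.tmsDist_shiftZ_le (-1) (by decide) (shiftZ (n + 1) z.1.1) (shiftZ (n + 1) w.1.1))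
    z.2.1 z.2.2 hτ
  simpa only [hlen, susp, TMS.shiftZ_shiftZ, TMS.shiftZ_zero, ← h] using key

theorem stepCost_nonneg {z w : Sigma1 V E} {c : ℝ} (hc : c ∈ stepCost z w) : 0 ≤ c := by
  rcases hc with ⟨-, rfl⟩ | ⟨-, rfl⟩
  · exact hlen_nonneg z w
  · exact vlen_nonneg z w

theorem exists_stepCost_susp_le {τ : ℝ} (hτ : |τ| < 1) {z w : Sigma1 V E} {c : ℝ}
    (hc : c ∈ stepCost z w) :
    ∃ c' ∈ stepCost (susp τ z) (susp τ w), c' ≤ (1 + Real.exp 1 ^ 2 * |τ|) * c := by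
  rcases hc with ⟨h, rfl⟩ | ⟨⟨t, ht⟩, rfl⟩
  · exact ⟨_, Or.inl ⟨congrArg (fun s => Int.fract (s + τ)) h, rfl⟩, hlen_susp_le hτ h⟩
  · refine ⟨_, Or.inr ⟨⟨t, (susp_susp_eq_iff t τ z w).2 ht⟩, rfl⟩, ?_⟩
    rw [vlen_susp]
    exact le_mul_of_one_le_left (vlen_nonneg z w) (le_add_of_nonneg_right (by positivity))

theorem exists_pathCosts_susp_le {τ : ℝ} (hτ : |τ| < 1) {z w : Sigma1 V E} {c : ℝ}
    (hc : c ∈ pathCosts z w) :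
    ∃ c' ∈ pathCosts (susp τ z) (susp τ w), c' ≤ (1 + Real.exp 1 ^ 2 * |τ|) * c := by
  obtain ⟨n, zs, cs, rfl, rfl, hcs, rfl⟩ := hc
  have hex : ∀ i, ∃ c', i < n → c' ∈ stepCost (susp τ (zs i)) (susp τ (zs (i + 1))) ∧
      c' ≤ (1 + Real.exp 1 ^ 2 * |τ|) * cs i := fun i => by
    by_cases hi : i < n
    · obtain ⟨c', h⟩ := exists_stepCost_susp_le hτ (hcs i hi)
      exact ⟨c', fun _ => h⟩
    · exact ⟨0, fun h => absurd h hi⟩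
  choose cs' hcs' using hex
  refine ⟨_, ⟨n, fun i => susp τ (zs i), cs', rfl, rfl, fun i hi => (hcs' i hi).1, rfl⟩, ?_⟩
  rw [Finset.mul_sum]
  exact Finset.sum_le_sum fun i hi => (hcs' i (Finset.mem_range.1 hi)).2

theorem pathCosts_nonneg {z w : Sigma1 V E} {c : ℝ} (hc : c ∈ pathCosts z w) : 0 ≤ c := by
  obtain ⟨n, zs, cs, -, -, hcs, rfl⟩ := hc
  exact Finset.sum_nonneg fun i hi => stepCost_nonneg (hcs i (Finset.mem_range.1 hi))

theorem d1_nonneg (z w : Sigma1 V E) : 0 ≤ d1 z w :=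
  Real.sInf_nonneg fun _ => pathCosts_nonneg

theorem d1_susp_le {τ : ℝ} (hτ : |τ| < 1) (z w : Sigma1 V E) :
    d1 (susp τ z) (susp τ w) ≤ (1 + Real.exp 1 ^ 2 * |τ|) * d1 z w := by
  have hK : 0 < 1 + Real.exp 1 ^ 2 * |τ| := by positivity
  rcases (pathCosts z w).eq_empty_or_nonempty with hemp | hne
  · have hemp' : pathCosts (susp τ z) (susp τ w) = ∅ := by
      refine Set.eq_empty_of_forall_notMem fun c hc => ?_
      obtain ⟨c', hc', -⟩ := exists_pathCosts_susp_le (τ := -τ) (by rwa [abs_neg]) hc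
      rw [susp_neg_susp, susp_neg_susp, hemp] at hc'
      exact hc'
    rw [d1, d1, hemp, hemp', Real.sInf_empty, mul_zero]
  · rw [← div_le_iff₀' hK]
    refine le_csInf hne fun c hc => ?_
    obtain ⟨c', hc', hle⟩ := exists_pathCosts_susp_le hτ hc
    rw [div_le_iff₀' hK]
    exact (csInf_le ⟨0, fun _ => pathCosts_nonneg⟩ hc').trans hle

end Sigma1

/-- the suspension flow with constant roof distorts the Bowen–Walters
metric `d_1` by at most a factor `1 + 2e²|τ|` for `|τ| < 1`. -/
theorem stmt18 (V : Type) (E : V → V → Prop)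
    (hin : ∀ v, ∃ u, E u v) (hout : ∀ v, ∃ w, E v w) :
    ∀ (z w : Sigma1 V E) (τ : ℝ), |τ| < 1 →
      (1 + 2 * Real.exp 1 ^ 2 * |τ|)⁻¹ * d1 z w ≤ d1 (susp τ z) (susp τ w) ∧
      d1 (susp τ z) (susp τ w) ≤ (1 + 2 * Real.exp 1 ^ 2 * |τ|) * d1 z w := by
  intro z w τ hτ
  have hK : 0 < 1 + 2 * Real.exp 1 ^ 2 * |τ| := by positivity
  have hmono : 1 + Real.exp 1 ^ 2 * |τ| ≤ 1 + 2 * Real.exp 1 ^ 2 * |τ| := by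
    linarith [show 0 ≤ Real.exp 1 ^ 2 * |τ| by positivity]
  constructor
  · rw [inv_mul_le_iff₀ hK]
    have h := Sigma1.d1_susp_le (τ := -τ) (by rwa [abs_neg]) (susp τ z) (susp τ w)
    rw [Sigma1.susp_neg_susp, Sigma1.susp_neg_susp, abs_neg] at h
    exact h.trans (mul_le_mul_of_nonneg_right hmono (Sigma1.d1_nonneg _ _))
  · exact (Sigma1.d1_susp_le hτ z w).trans
      (mul_le_mul_of_nonneg_right hmono (Sigma1.d1_nonneg _ _))
end
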